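/- (Theorem 4.2, part 2: asymptotic stability in the large) Under the standing hypotheses with ρ = ∞ (i.e. F'(z) ≤ k for all z ∈ ℝ) and τ = 0 (so a ≤ A is bounded by a constant), if ∫₀^∞ dt/g(t) = ∞ and either C'(t) ≤ 0 for all t ≥ 0 or C'(t) → 0 as t → ∞, then the null solution is asymptotically stable in the large: it is stable, and there exists κ ≥ 0 such that for every t₀ ≥ κ, every α > 0, and every classical solution u on [t₀,∞) with d(t₀) < α, one has d(t) → 0 as t → ∞; moreover for every ν > 0 there exists T(α, ν, t₀, u) > 0 with d(t) < ν for all t ≥ t₀ + T. -/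

import Mathlib

open Real Set MeasureTheory Filter

/-- A classical solution on `[t₀, ∞)` of the initial-boundary-value problem
`-ε(t) u_xxt + u_tt - C(t) u_xx + a' u_t = F(u) - a u_t` on `(0,π) × (t₀,∞)`,
with Dirichlet boundary conditions `u(0,t) = u(π,t) = 0`.  The partial
derivatives are recorded as data, together with the hypotheses that they really
are the derivatives and that all of them are continuous on the closed
space-time domain. -/
structure ClassicalSolution (ε C F : ℝ → ℝ) (a' t₀ : ℝ) where
  u : ℝ → ℝ → ℝ
  ux : ℝ → ℝ → ℝ
  uxx : ℝ → ℝ → ℝ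
  ut : ℝ → ℝ → ℝ
  utt : ℝ → ℝ → ℝ
  uxxt : ℝ → ℝ → ℝ
  aa : ℝ → ℝ → ℝ
  hux : ∀ t ∈ Ici t₀, ∀ x ∈ Icc (0:ℝ) π,
    HasDerivWithinAt (fun y => u y t) (ux x t) (Icc 0 π) x
  huxx : ∀ t ∈ Ici t₀, ∀ x ∈ Icc (0:ℝ) π,
    HasDerivWithinAt (fun y => ux y t) (uxx x t) (Icc 0 π) x
  hut : ∀ x ∈ Icc (0:ℝ) π, ∀ t ∈ Ici t₀,
    HasDerivWithinAt (fun s => u x s) (ut x t) (Ici t₀) t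
  hutt : ∀ x ∈ Icc (0:ℝ) π, ∀ t ∈ Ici t₀,
    HasDerivWithinAt (fun s => ut x s) (utt x t) (Ici t₀) t
  huxxt : ∀ x ∈ Icc (0:ℝ) π, ∀ t ∈ Ici t₀,
    HasDerivWithinAt (fun s => uxx x s) (uxxt x t) (Ici t₀) t
  cont_u : ContinuousOn (Function.uncurry u) (Icc 0 π ×ˢ Ici t₀)
  cont_ux : ContinuousOn (Function.uncurry ux) (Icc 0 π ×ˢ Ici t₀)
  cont_uxx : ContinuousOn (Function.uncurry uxx) (Icc 0 π ×ˢ Ici t₀)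
  cont_ut : ContinuousOn (Function.uncurry ut) (Icc 0 π ×ˢ Ici t₀)
  cont_utt : ContinuousOn (Function.uncurry utt) (Icc 0 π ×ˢ Ici t₀)
  cont_uxxt : ContinuousOn (Function.uncurry uxxt) (Icc 0 π ×ˢ Ici t₀)
  cont_aa : ContinuousOn (Function.uncurry aa) (Icc 0 π ×ˢ Ici t₀)
  aa_nonneg : ∀ x ∈ Icc (0:ℝ) π, ∀ t ∈ Ici t₀, 0 ≤ aa x t
  pde : ∀ x ∈ Ioo (0:ℝ) π, ∀ t ∈ Ioi t₀,
    -(ε t) * uxxt x t + utt x t - C t * uxx x t + a' * ut x t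
      = F (u x t) - aa x t * ut x t
  bc0 : ∀ t ∈ Ici t₀, u 0 t = 0
  bcπ : ∀ t ∈ Ici t₀, u π t = 0

/-- The time-dependent norm `d(t)` of a solution:
`d(t)² = ∫₀^π [ε(t)² u_xx² + u_x² + u² + u_t²] dx`. -/
noncomputable def ClassicalSolution.d {ε C F : ℝ → ℝ} {a' t₀ : ℝ}
    (S : ClassicalSolution ε C F a' t₀) (t : ℝ) : ℝ :=
  Real.sqrt (∫ x in (0:ℝ)..π,
    ((ε t)^2 * (S.uxx x t)^2 + (S.ux x t)^2 + (S.u x t)^2 + (S.ut x t)^2))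


lemma aux_ibp {u v u' v' : ℝ → ℝ}
    (hu : ∀ x ∈ Icc (0:ℝ) π, HasDerivWithinAt u (u' x) (Icc 0 π) x)
    (hv : ∀ x ∈ Icc (0:ℝ) π, HasDerivWithinAt v (v' x) (Icc 0 π) x)
    (hu' : ContinuousOn u' (Icc 0 π)) (hv' : ContinuousOn v' (Icc 0 π))
    (h0 : u 0 = 0) (h1 : u π = 0) :
    ∫ x in (0:ℝ)..π, u x * v' x = - ∫ x in (0:ℝ)..π, u' x * v x := by
  have hp : (0:ℝ) ≤ π := pi_pos.le
  have e : uIcc (0:ℝ) π = Icc 0 π := uIcc_of_le hp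
  have := intervalIntegral.integral_mul_deriv_eq_deriv_mul_of_hasDerivAt
    (u := u) (v := v) (u' := u') (v' := v') (a := 0) (b := π)
    (by rw [e]; exact fun x hx => (hu x hx).continuousWithinAt)
    (by rw [e]; exact fun x hx => (hv x hx).continuousWithinAt)
    (by rw [min_eq_left hp, max_eq_right hp]
        exact fun x hx => (hu x (Ioo_subset_Icc_self hx)).hasDerivAt (Icc_mem_nhds hx.1 hx.2))
    (by rw [min_eq_left hp, max_eq_right hp]
        exact fun x hx => (hv x (Ioo_subset_Icc_self hx)).hasDerivAt (Icc_mem_nhds hx.1 hx.2))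
    (by apply ContinuousOn.intervalIntegrable; rwa [e])
    (by apply ContinuousOn.intervalIntegrable; rwa [e])
  rw [this, h0, h1]; ring

lemma aux_ii {f : ℝ → ℝ} (hf : ContinuousOn f (Icc 0 π)) : IntervalIntegrable f volume 0 π := by
  apply ContinuousOn.intervalIntegrable; rwa [uIcc_of_le pi_pos.le]

lemma aux_sin_bound {x : ℝ} (hx : x ∈ Icc (0:ℝ) π) : min x (π - x) ≤ π / 2 * sin x := by
  have hpi := pi_pos
  rcases le_total x (π/2) with h | h
  · have := mul_le_sin hx.1 h
    refine (min_le_left _ _).trans ?_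
    have e : π / 2 * (2 / π * x) = x := by field_simp
    nlinarith
  · have := mul_le_sin (x := π - x) (by linarith [hx.2]) (by linarith)
    rw [sin_pi_sub] at this
    refine (min_le_right _ _).trans ?_
    have e : π / 2 * (2 / π * (π - x)) = π - x := by field_simp
    nlinarith

lemma aux_poincare {u u' : ℝ → ℝ}
    (hu : ∀ x ∈ Icc (0:ℝ) π, HasDerivWithinAt u (u' x) (Icc 0 π) x)
    (hu' : ContinuousOn u' (Icc 0 π))
    (h0 : u 0 = 0) (h1 : u π = 0) :
    ∫ x in (0:ℝ)..π, u x ^ 2 ≤ ∫ x in (0:ℝ)..π, u' x ^ 2 := by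
  have hpi := pi_pos
  have hp : (0:ℝ) ≤ π := pi_pos.le
  have huc : ContinuousOn u (Icc 0 π) := fun x hx => (hu x hx).continuousWithinAt
  obtain ⟨B, hB⟩ := isCompact_Icc.exists_bound_of_continuousOn hu'
  have hB0 : 0 ≤ B := (norm_nonneg _).trans (hB 0 (left_mem_Icc.2 hp))
  have hlip : ∀ x ∈ Icc (0:ℝ) π, |u x| ≤ B * (π / 2) * sin x := by
    intro x hx
    have a1 := (convex_Icc (0:ℝ) π).norm_image_sub_le_of_norm_hasDerivWithin_le hu hB
      (left_mem_Icc.2 hp) hx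
    have a2 := (convex_Icc (0:ℝ) π).norm_image_sub_le_of_norm_hasDerivWithin_le hu hB
      (right_mem_Icc.2 hp) hx
    rw [h0, sub_zero, sub_zero, Real.norm_eq_abs, Real.norm_eq_abs, abs_of_nonneg hx.1] at a1
    rw [h1, sub_zero, Real.norm_eq_abs, Real.norm_eq_abs, abs_sub_comm x π,
      abs_of_nonneg (show 0 ≤ π - x by linarith [hx.2])] at a2
    have : |u x| ≤ B * min x (π - x) := by
      rcases min_choice x (π - x) with h | h <;> rw [h] <;> assumption
    nlinarith [aux_sin_bound hx]
  set g : ℝ → ℝ := fun x => u x ^ 2 * cos x / sin x with hg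
  have hgb : ∀ x ∈ Icc (0:ℝ) π, ‖g x‖ ≤ B * (π / 2) * |u x| := by
    intro x hx
    have hs := sin_nonneg_of_mem_Icc hx
    simp only [hg, Real.norm_eq_abs, abs_div, abs_mul, abs_pow, abs_of_nonneg hs]
    apply div_le_of_le_mul₀ hs (by positivity)
    have := hlip x hx
    have c1 := abs_cos_le_one x
    calc |u x| ^ 2 * |cos x| ≤ |u x| ^ 2 * 1 := by gcongr
      _ = |u x| * |u x| := by ring
      _ ≤ |u x| * (B * (π / 2) * sin x) := by gcongr
      _ = _ := by ring
  have hend : ∀ x ∈ Icc (0:ℝ) π, u x = 0 → ContinuousWithinAt g (Icc 0 π) x := by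
    intro x hx hux
    have gx : g x = 0 := by simp [hg, hux]
    unfold ContinuousWithinAt
    rw [gx]
    apply squeeze_zero_norm' (a := fun x => B * (π / 2) * |u x|)
    · filter_upwards [self_mem_nhdsWithin] with y hy using hgb y hy
    · have : ContinuousWithinAt (fun x => B * (π / 2) * |u x|) (Icc 0 π) x :=
        continuousWithinAt_const.mul (huc x hx).abs
      have h2 := this.tendsto
      simpa [hux] using h2
  have hd : ∀ x ∈ Ioo (0:ℝ) π, HasDerivAt g
      (((2 * u x * u' x) * cos x + u x ^ 2 * (- sin x)) / sin x
        - u x ^ 2 * cos x * cos x / sin x ^ 2) x := by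
    intro x hx
    have hs := (sin_pos_of_mem_Ioo hx).ne'
    have d1 := (hu x (Ioo_subset_Icc_self hx)).hasDerivAt (Icc_mem_nhds hx.1 hx.2)
    have d2 := ((d1.pow 2).mul (hasDerivAt_cos x)).div (hasDerivAt_sin x) hs
    refine d2.congr_deriv ?_
    simp
    field_simp
  have hgc : ContinuousOn g (Icc 0 π) := by
    intro x hx
    rcases eq_or_lt_of_le hx.1 with h | h
    · exact hend x hx (h ▸ h0)
    rcases eq_or_lt_of_le hx.2 with h' | h'
    · exact hend x hx (h'.symm ▸ h1)
    exact (hd x ⟨h, h'⟩).continuousAt.continuousWithinAt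
  have key := intervalIntegral.sub_le_integral_of_hasDeriv_right_of_le hp hgc
    (fun x hx => (hd x hx).hasDerivWithinAt) (φ := fun x => u' x ^ 2 - u x ^ 2)
    (((hu'.pow 2).sub (huc.pow 2)).integrableOn_Icc) (by
      intro x hx
      have hs := (sin_pos_of_mem_Ioo hx).ne'
      have e : (((2 * u x * u' x) * cos x + u x ^ 2 * (- sin x)) / sin x
        - u x ^ 2 * cos x * cos x / sin x ^ 2) = 2 * u x * u' x * (cos x / sin x) - u x ^ 2
          - u x ^ 2 * (cos x / sin x) ^ 2 := by
        field_simp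
        ring
      rw [e]
      nlinarith [sq_nonneg (u' x - u x * (cos x / sin x))])
  rw [intervalIntegral.integral_sub (f := fun x => u' x ^ 2) (g := fun x => u x ^ 2)
    (aux_ii (hu'.pow 2)) (aux_ii (huc.pow 2))] at key
  simp [hg, h0, h1] at key
  linarith

lemma aux_sup {u u' : ℝ → ℝ}
    (hu : ∀ x ∈ Icc (0:ℝ) π, HasDerivWithinAt u (u' x) (Icc 0 π) x)
    (hu' : ContinuousOn u' (Icc 0 π)) (h0 : u 0 = 0) :
    ∀ x ∈ Icc (0:ℝ) π, |u x| ≤ π + ∫ x in (0:ℝ)..π, u' x ^ 2 := by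
  intro x hx
  have huc : ContinuousOn u (Icc 0 π) := fun x hx => (hu x hx).continuousWithinAt
  have hsub : Icc 0 x ⊆ Icc 0 π := Icc_subset_Icc le_rfl hx.2
  have hi : IntervalIntegrable u' volume 0 x := by
    apply ContinuousOn.intervalIntegrable; rw [uIcc_of_le hx.1]; exact hu'.mono hsub
  have e : ∫ y in (0:ℝ)..x, u' y = u x - u 0 :=
    intervalIntegral.integral_eq_sub_of_hasDerivAt_of_le hx.1 (huc.mono hsub)
      (fun y hy => (hu y ⟨hy.1.le, hy.2.le.trans hx.2⟩).hasDerivAt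
        (Icc_mem_nhds hy.1 (hy.2.trans_le hx.2))) hi
  rw [h0, sub_zero] at e
  rw [← e]
  have hc : ContinuousOn (fun y => 1 + u' y ^ 2) (Icc 0 π) := by fun_prop
  calc |∫ y in (0:ℝ)..x, u' y| ≤ ∫ y in (0:ℝ)..x, |u' y| :=
        intervalIntegral.abs_integral_le_integral_abs hx.1
    _ ≤ ∫ y in (0:ℝ)..x, (1 + u' y ^ 2) := by
        apply intervalIntegral.integral_mono_on hx.1 hi.abs
        · apply ContinuousOn.intervalIntegrable; rw [uIcc_of_le hx.1]; exact hc.mono hsub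
        · intro y _
          rw [← sq_abs (u' y)]
          nlinarith [sq_nonneg (|u' y| - 1), abs_nonneg (u' y)]
    _ ≤ ∫ y in (0:ℝ)..π, (1 + u' y ^ 2) := by
        apply intervalIntegral.integral_mono_interval le_rfl hx.1 hx.2
        · exact Filter.Eventually.of_forall fun y => by positivity
        · exact aux_ii hc
    _ = _ := by
        rw [intervalIntegral.integral_add (f := fun _ => (1:ℝ)) (g := fun x => u' x ^ 2) (by simp)
          (aux_ii (hu'.pow 2))]; simp

lemma aux_leibniz {f f' : ℝ → ℝ → ℝ} {t₀ : ℝ}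
    (hd : ∀ x ∈ Icc (0:ℝ) π, ∀ t ∈ Ioi t₀, HasDerivAt (fun s => f x s) (f' x t) t)
    (hc : ContinuousOn (Function.uncurry f) (Icc 0 π ×ˢ Ici t₀))
    (hc' : ContinuousOn (Function.uncurry f') (Icc 0 π ×ˢ Ici t₀)) {t : ℝ} (ht : t₀ < t) :
    HasDerivAt (fun s => ∫ x in (0:ℝ)..π, f x s) (∫ x in (0:ℝ)..π, f' x t) t := by
  have hp := pi_pos.le
  have sl : ∀ {g : ℝ → ℝ → ℝ}, ContinuousOn (Function.uncurry g) (Icc 0 π ×ˢ Ici t₀) →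
      ∀ s, t₀ ≤ s → ContinuousOn (fun x => g x s) (Icc 0 π) := by
    intro g hg s hs
    exact hg.comp (f := fun x => (x, s)) (by fun_prop) (fun x hx => ⟨hx, hs⟩)
  have hK : IsCompact (Icc (0:ℝ) π ×ˢ Icc t₀ (t+1)) := isCompact_Icc.prod isCompact_Icc
  obtain ⟨B, hB⟩ := hK.exists_bound_of_continuousOn
    (hc'.mono (prod_mono_right Icc_subset_Ici_self))
  have hsub : uIoc (0:ℝ) π ⊆ Icc 0 π := by rw [uIoc_of_le hp]; exact Ioc_subset_Icc_self
  refine (intervalIntegral.hasDerivAt_integral_of_dominated_loc_of_deriv_le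
    (F := fun s x => f x s) (F' := fun s x => f' x s) (bound := fun _ => B)
    (s := Ioo t₀ (t+1)) (Ioo_mem_nhds ht (by linarith)) ?_ (aux_ii (sl hc t ht.le)) ?_ ?_ (by simp)
    ?_).2
  · filter_upwards [Ioi_mem_nhds ht] with s hs
    exact (aux_ii (sl hc s (le_of_lt hs))).def'.aestronglyMeasurable
  · exact (aux_ii (sl hc' t ht.le)).def'.aestronglyMeasurable
  · exact Filter.Eventually.of_forall fun x hx s hs => hB (x, s) ⟨hsub hx, hs.1.le, hs.2.le⟩
  · exact Filter.Eventually.of_forall fun x hx s hs => hd x (hsub hx) s hs.1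

lemma aux_param_cont {f : ℝ → ℝ → ℝ} {t₀ : ℝ}
    (hc : ContinuousOn (Function.uncurry f) (Icc 0 π ×ˢ Ici t₀)) :
    ContinuousOn (fun s => ∫ x in (0:ℝ)..π, f x s) (Ici t₀) := by
  have hp := pi_pos.le
  have h1 : Continuous (Function.uncurry fun (s x : ℝ) => f (max 0 (min x π)) (max s t₀)) := by
    have : ContinuousOn (Function.uncurry f ∘ fun q : ℝ × ℝ => (max 0 (min q.2 π), max q.1 t₀))
        univ := by
      apply hc.comp (by fun_prop)
      intro q _
      exact ⟨⟨le_max_left _ _, max_le hp (min_le_right _ _)⟩, mem_Ici.2 (le_max_right _ _)⟩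
    exact continuousOn_univ.1 this
  have h2 := intervalIntegral.continuous_parametric_intervalIntegral_of_continuous'
    (μ := volume) h1 0 π
  refine h2.continuousOn.congr ?_
  intro s hs
  apply intervalIntegral.integral_congr
  intro x hx
  rw [uIcc_of_le hp] at hx
  simp only
  rw [min_eq_left hx.2, max_eq_right hx.1, max_eq_left hs]

lemma aux_second {φ ψ : ℝ → ℝ} {t q : ℝ} (h0 : ∀ s, t ≤ s → 0 ≤ φ s) (ht : φ t = 0)
    (hφ : ∀ s, t ≤ s → HasDerivAt φ (2 * ψ s) s) (hψt : ψ t = 0) (hψ : HasDerivAt ψ q t) :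
    0 ≤ q := by
  by_contra hq
  push Not at hq
  have h1 := hasDerivAt_iff_tendsto_slope.1 hψ
  have h2 : ∀ᶠ s in nhdsWithin t {t}ᶜ, slope ψ t s < 0 := h1.eventually_lt_const hq
  rw [eventually_nhdsWithin_iff, Metric.eventually_nhds_iff] at h2
  obtain ⟨δ, hδ, h3⟩ := h2
  have h4 : ∀ s ∈ Ioo t (t + δ), ψ s < 0 := by
    intro s hs
    have := h3 (y := s) (by rw [Real.dist_eq, abs_of_pos (by linarith [hs.1])]; linarith [hs.2])
      (by simpa using hs.1.ne')
    rw [slope_def_field, hψt, sub_zero, div_neg_iff] at this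
    rcases this with h | h
    · linarith [hs.1]
    · exact h.1
  have h5 : StrictAntiOn φ (Icc t (t + δ / 2)) := by
    apply strictAntiOn_of_deriv_neg (convex_Icc _ _)
    · exact fun s hs => (hφ s hs.1).continuousAt.continuousWithinAt
    · intro s hs
      rw [interior_Icc] at hs
      rw [(hφ s hs.1.le).deriv]
      linarith [h4 s ⟨hs.1, by linarith [hs.2]⟩]
  have := h5 (left_mem_Icc.2 (by linarith)) (right_mem_Icc.2 (by linarith)) (by linarith)
  have := h0 (t + δ / 2) (by linarith)
  linarith

lemma aux_F_mul {G G' : ℝ → ℝ} {l M : ℝ} (hG : ∀ z, HasDerivAt G (G' z) z) (h0 : G 0 = 0)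
    (hl : ∀ z, |z| ≤ M → G' z ≤ l) : ∀ z, 0 ≤ z → z ≤ M → G z ≤ l * z := by
  intro z hz hzM
  have := (convex_Icc 0 z).image_sub_le_mul_sub_of_deriv_le (f := G) (C := l)
    (fun y _ => (hG y).continuousAt.continuousWithinAt)
    (fun y _ => (hG y).differentiableAt.differentiableWithinAt)
    (by
      intro y hy
      rw [interior_Icc] at hy
      rw [(hG y).deriv]
      exact hl y (by rw [abs_of_pos hy.1]; linarith [hy.2])) 0 (left_mem_Icc.2 hz) z
    (right_mem_Icc.2 hz) hz
  simpa [h0] using this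

lemma aux_Phi_pos {G G' : ℝ → ℝ} {l M : ℝ} (hG : ∀ z, HasDerivAt G (G' z) z) (h0 : G 0 = 0)
    (hl : ∀ z, |z| ≤ M → G' z ≤ l) : ∀ z, 0 ≤ z → z ≤ M →
      2 * ∫ y in (0:ℝ)..z, G y ≤ l * z ^ 2 := by
  intro z hz hzM
  have hc : Continuous G := continuous_iff_continuousAt.2 fun z => (hG z).continuousAt
  have : ∫ y in (0:ℝ)..z, G y ≤ ∫ y in (0:ℝ)..z, l * y := by
    apply intervalIntegral.integral_mono_on hz (hc.intervalIntegrable _ _)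
      ((by fun_prop : Continuous fun y => l * y).intervalIntegrable _ _)
    intro y hy
    exact aux_F_mul hG h0 hl y hy.1 (hy.2.trans hzM)
  rw [intervalIntegral.integral_const_mul, integral_id] at this
  nlinarith

lemma aux_Phi {G G' : ℝ → ℝ} {l M : ℝ} (hG : ∀ z, HasDerivAt G (G' z) z) (h0 : G 0 = 0)
    (hl : ∀ z, |z| ≤ M → G' z ≤ l) (z : ℝ) (hz : |z| ≤ M) :
      2 * ∫ y in (0:ℝ)..z, G y ≤ l * z ^ 2 ∧ G z * z ≤ l * z ^ 2 := by
  have hG2 : ∀ z, HasDerivAt (fun y => - G (-y)) (G' (-z)) z := by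
    intro z
    have := ((hG (-z)).comp z (hasDerivAt_neg z)).neg
    exact this.congr_deriv (by ring)
  rcases le_total 0 z with h | h
  · rw [abs_of_nonneg h] at hz
    refine ⟨aux_Phi_pos hG h0 hl z h hz, ?_⟩
    have := aux_F_mul hG h0 hl z h hz
    nlinarith
  · rw [abs_of_nonpos h] at hz
    have a1 := aux_Phi_pos hG2 (by simp [h0]) (l := l) (M := M)
      (fun y hy => hl (-y) (by rwa [abs_neg])) (-z) (by linarith) hz
    have a2 := aux_F_mul hG2 (by simp [h0]) (l := l) (M := M)
      (fun y hy => hl (-y) (by rwa [abs_neg])) (-z) (by linarith) hz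
    simp only [neg_neg] at a2
    rw [intervalIntegral.integral_neg, intervalIntegral.integral_comp_neg, neg_neg, neg_zero,
      intervalIntegral.integral_symm] at a1
    constructor
    · nlinarith
    · nlinarith

namespace ClassicalSolution

variable {ε C F : ℝ → ℝ} {a' t₀ : ℝ}

lemma slice {g : ℝ → ℝ → ℝ}
    (hg : ContinuousOn (Function.uncurry g) (Icc 0 π ×ˢ Ici t₀)) {s : ℝ} (hs : t₀ ≤ s) :
    ContinuousOn (fun x => g x s) (Icc 0 π) :=
  hg.comp (f := fun x => (x, s)) (by fun_prop) (fun x hx => ⟨hx, hs⟩)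

lemma dAt {f f' : ℝ → ℝ → ℝ}
    (h : ∀ x ∈ Icc (0:ℝ) π, ∀ t ∈ Ici t₀, HasDerivWithinAt (fun s => f x s) (f' x t) (Ici t₀) t) :
    ∀ x ∈ Icc (0:ℝ) π, ∀ t ∈ Ioi t₀, HasDerivAt (fun s => f x s) (f' x t) t :=
  fun x hx t ht => (h x hx t (mem_Ici.2 (le_of_lt ht))).hasDerivAt (Ici_mem_nhds ht)

lemma sym (S : ClassicalSolution ε C F a' t₀) {r s : ℝ} (hr : t₀ ≤ r) (hs : t₀ ≤ s) :
    ∫ x in (0:ℝ)..π, S.u x r * S.uxx x s = ∫ x in (0:ℝ)..π, S.u x s * S.uxx x r := by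
  rw [aux_ibp (S.hux r hr) (S.huxx s hs) (slice S.cont_ux hr) (slice S.cont_uxx hs)
    (S.bc0 r hr) (S.bcπ r hr),
    aux_ibp (S.hux s hs) (S.huxx r hr) (slice S.cont_ux hs) (slice S.cont_uxx hr)
    (S.bc0 s hs) (S.bcπ s hs)]
  simp only [mul_comm]

lemma D_eq (S : ClassicalSolution ε C F a' t₀) {r : ℝ} (hr : t₀ ≤ r) :
    ∫ x in (0:ℝ)..π, S.u x r * S.uxx x r = - ∫ x in (0:ℝ)..π, S.ux x r ^ 2 := by
  rw [aux_ibp (S.hux r hr) (S.huxx r hr) (slice S.cont_ux hr) (slice S.cont_uxx hr)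
    (S.bc0 r hr) (S.bcπ r hr)]
  simp only [pow_two]

lemma F_eq (S : ClassicalSolution ε C F a' t₀) {F' : ℝ → ℝ} (hF : ∀ z, HasDerivAt F (F' z) z)
    (hF' : Continuous F') (hF0 : F 0 = 0) {r : ℝ} (hr : t₀ ≤ r) :
    ∫ x in (0:ℝ)..π, F (S.u x r) * S.uxx x r
      = - ∫ x in (0:ℝ)..π, F' (S.u x r) * S.ux x r ^ 2 := by
  rw [aux_ibp (u := fun x => F (S.u x r)) (u' := fun x => F' (S.u x r) * S.ux x r)
    (fun x hx => (hF (S.u x r)).comp_hasDerivWithinAt x (S.hux r hr x hx))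
    (S.huxx r hr)
    ((hF'.comp_continuousOn (slice S.cont_u hr)).mul (slice S.cont_ux hr))
    (slice S.cont_uxx hr)
    (by rw [S.bc0 r hr, hF0]) (by rw [S.bcπ r hr, hF0])]
  simp only [pow_two, mul_assoc]

lemma poinc (S : ClassicalSolution ε C F a' t₀) {r : ℝ} (hr : t₀ ≤ r) :
    ∫ x in (0:ℝ)..π, S.u x r ^ 2 ≤ ∫ x in (0:ℝ)..π, S.ux x r ^ 2 :=
  aux_poincare (S.hux r hr) (slice S.cont_ux hr) (S.bc0 r hr) (S.bcπ r hr)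

lemma mulconst {g : ℝ → ℝ → ℝ} {c : ℝ → ℝ}
    (hg : ContinuousOn (Function.uncurry g) (Icc 0 π ×ˢ Ici t₀))
    (hc : ContinuousOn c (Icc 0 π)) :
    ContinuousOn (Function.uncurry fun x s => c x * g x s) (Icc 0 π ×ˢ Ici t₀) :=
  (hc.comp (f := Prod.fst) (by fun_prop) (fun q hq => hq.1)).mul hg

lemma sym_t (S : ClassicalSolution ε C F a' t₀) {r s : ℝ} (hr : t₀ ≤ r) (hs : t₀ < s) :
    ∫ x in (0:ℝ)..π, S.u x r * S.uxxt x s = ∫ x in (0:ℝ)..π, S.uxx x r * S.ut x s := by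
  have h1 := aux_leibniz (f := fun x s => S.u x r * S.uxx x s)
    (f' := fun x s => S.u x r * S.uxxt x s) (t₀ := t₀)
    (fun x hx t ht => (dAt S.huxxt x hx t ht).const_mul _)
    (mulconst S.cont_uxx (slice S.cont_u hr)) (mulconst S.cont_uxxt (slice S.cont_u hr)) hs
  have h2 := aux_leibniz (f := fun x s => S.uxx x r * S.u x s)
    (f' := fun x s => S.uxx x r * S.ut x s) (t₀ := t₀)
    (fun x hx t ht => (dAt S.hut x hx t ht).const_mul _)
    (mulconst S.cont_u (slice S.cont_uxx hr)) (mulconst S.cont_ut (slice S.cont_uxx hr)) hs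
  refine h1.unique (h2.congr_of_eventuallyEq ?_)
  filter_upwards [Ioi_mem_nhds hs] with q hq
  rw [S.sym hr (le_of_lt hq)]
  simp only [mul_comm]

lemma cont_lift {c : ℝ → ℝ} (hc : ContinuousOn c (Icc 0 π)) :
    ContinuousOn (fun q : ℝ × ℝ => c q.1) (Icc 0 π ×ˢ Ici t₀) :=
  hc.comp (f := Prod.fst) (by fun_prop) (fun q hq => hq.1)

lemma diss (S : ClassicalSolution ε C F a' t₀) {t : ℝ} (ht : t₀ < t) :
    ∫ x in (0:ℝ)..π, S.ut x t ^ 2 ≤ - ∫ x in (0:ℝ)..π, S.ut x t * S.uxxt x t := by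
  have cu := slice S.cont_u ht.le
  have cuxx := slice S.cont_uxx ht.le
  have lu := cont_lift (t₀ := t₀) cu
  have luxx := cont_lift (t₀ := t₀) cuxx
  have Cu := S.cont_u
  have Cuxx := S.cont_uxx
  have Cut := S.cont_ut
  have Cutt := S.cont_utt
  have Cuxxt := S.cont_uxxt
  have h := aux_second (t := t)
    (φ := fun s => ∫ x in (0:ℝ)..π, (-((S.u x s - S.u x t) * (S.uxx x s - S.uxx x t))
      - (S.u x s - S.u x t) ^ 2))
    (ψ := fun s => ∫ x in (0:ℝ)..π, (-(S.ut x s * (S.uxx x s - S.uxx x t))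
      - (S.u x s - S.u x t) * S.ut x s))
    (q := ∫ x in (0:ℝ)..π, (-(S.ut x t * S.uxxt x t) - S.ut x t ^ 2)) ?_ (by simp) ?_ (by simp) ?_
  · have c1 := slice Cut ht.le
    have c2 := slice Cuxxt ht.le
    rw [intervalIntegral.integral_sub, intervalIntegral.integral_neg] at h
    · linarith
    · exact aux_ii (by fun_prop)
    · exact aux_ii (by fun_prop)
  · intro s hs
    have hs0 : t₀ ≤ s := ht.le.trans hs
    have du : ∀ x ∈ Icc (0:ℝ) π, HasDerivWithinAt (fun x => S.u x s - S.u x t)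
      (S.ux x s - S.ux x t) (Icc 0 π) x :=
      fun x hx => (S.hux s hs0 x hx).sub (S.hux t ht.le x hx)
    have dux : ∀ x ∈ Icc (0:ℝ) π, HasDerivWithinAt (fun x => S.ux x s - S.ux x t)
      (S.uxx x s - S.uxx x t) (Icc 0 π) x :=
      fun x hx => (S.huxx s hs0 x hx).sub (S.huxx t ht.le x hx)
    have c1 := slice S.cont_u hs0
    have c2 := slice S.cont_u ht.le
    have c3 := slice S.cont_ux hs0
    have c4 := slice S.cont_ux ht.le
    have c5 := slice S.cont_uxx hs0
    have c6 := slice S.cont_uxx ht.le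
    have p := aux_poincare du (by fun_prop) (by simp [S.bc0 s hs0, S.bc0 t ht.le])
      (by simp [S.bcπ s hs0, S.bcπ t ht.le])
    have i := aux_ibp du dux (by fun_prop) (by fun_prop) (by simp [S.bc0 s hs0, S.bc0 t ht.le])
      (by simp [S.bcπ s hs0, S.bcπ t ht.le])
    rw [intervalIntegral.integral_sub, intervalIntegral.integral_neg, i]
    · simp only [neg_neg, ← pow_two]
      linarith
    · exact aux_ii (by fun_prop)
    · exact aux_ii (by fun_prop)
  · intro s hs
    have hs0 : t₀ < s := ht.trans_le hs
    have h1 := aux_leibniz (t₀ := t₀)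
      (f := fun x s => (-((S.u x s - S.u x t) * (S.uxx x s - S.uxx x t))
        - (S.u x s - S.u x t) ^ 2))
      (f' := fun x s => (-(S.ut x s * (S.uxx x s - S.uxx x t) +
        (S.u x s - S.u x t) * S.uxxt x s)
        - 2 * (S.u x s - S.u x t) * S.ut x s)) ?_ ?_ ?_ hs0
    · refine h1.congr_deriv ?_
      have c0 := slice S.cont_ut hs0.le
      have c1 := slice S.cont_u hs0.le
      have c5 := slice S.cont_uxx hs0.le
      have c6 := slice S.cont_uxxt hs0.le
      have e1 := S.sym_t ht.le hs0
      have e2 := S.sym_t hs0.le hs0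
      rw [← intervalIntegral.integral_const_mul]
      have i1 : IntervalIntegrable (fun x => S.u x t * S.uxxt x s) volume 0 π :=
        aux_ii (by fun_prop)
      have i2 : IntervalIntegrable (fun x => S.u x s * S.uxxt x s) volume 0 π :=
        aux_ii (by fun_prop)
      have i3 : IntervalIntegrable (fun x => S.uxx x t * S.ut x s) volume 0 π :=
        aux_ii (by fun_prop)
      have i4 : IntervalIntegrable (fun x => S.uxx x s * S.ut x s) volume 0 π :=
        aux_ii (by fun_prop)
      rw [← sub_eq_zero, ← intervalIntegral.integral_sub (aux_ii (by fun_prop))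
        (aux_ii (by fun_prop))]
      have : ∫ x in (0:ℝ)..π, ((S.uxx x s * S.ut x s - S.u x s * S.uxxt x s)
          - (S.uxx x t * S.ut x s - S.u x t * S.uxxt x s)) = 0 := by
        rw [intervalIntegral.integral_sub (i4.sub i2) (i3.sub i1),
          intervalIntegral.integral_sub i4 i2, intervalIntegral.integral_sub i3 i1]
        linarith
      refine Eq.trans ?_ this
      apply intervalIntegral.integral_congr
      intro x _
      simp only
      ring
    · intro x hx q hq
      have d1 := dAt S.hut x hx q hq
      have d2 := dAt S.huxxt x hx q hq
      have := (((d1.sub_const (S.u x t)).mul (d2.sub_const (S.uxx x t))).neg).sub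
        ((d1.sub_const (S.u x t)).pow 2)
      exact this.congr_deriv (by simp)
    · exact (((Cu.sub lu).mul (Cuxx.sub luxx)).neg).sub ((Cu.sub lu).pow 2)
    · exact (((Cut.mul (Cuxx.sub luxx)).add ((Cu.sub lu).mul Cuxxt)).neg).sub
        ((continuousOn_const.mul (Cu.sub lu)).mul Cut)
  · have h1 := aux_leibniz (t₀ := t₀)
      (f := fun x s => (-(S.ut x s * (S.uxx x s - S.uxx x t))
      - (S.u x s - S.u x t) * S.ut x s))
      (f' := fun x s => (-(S.utt x s * (S.uxx x s - S.uxx x t) + S.ut x s * S.uxxt x s)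
        - (S.ut x s * S.ut x s + (S.u x s - S.u x t) * S.utt x s))) ?_ ?_ ?_ ht
    · refine h1.congr_deriv ?_
      apply intervalIntegral.integral_congr
      intro x _
      simp only
      ring
    · intro x hx q hq
      have d1 := dAt S.hut x hx q hq
      have d2 := dAt S.huxxt x hx q hq
      have d3 := dAt S.hutt x hx q hq
      exact ((d3.mul (d2.sub_const (S.uxx x t))).neg).sub ((d1.sub_const (S.u x t)).mul d3)
    · exact ((Cut.mul (Cuxx.sub luxx)).neg).sub ((Cu.sub lu).mul Cut)
    · exact ((Cutt.mul (Cuxx.sub luxx)).add (Cut.mul Cuxxt)).neg.sub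
        ((Cut.mul Cut).add ((Cu.sub lu).mul Cutt))

end ClassicalSolution

lemma aux_pt_deriv {U Y W Z T a f e e1 c P P' γ θ k μ A a' : ℝ}
    (he : 0 ≤ e) (hμ : 0 < μ) (ha' : 0 ≤ a') (hγ : 0 ≤ γ) (hθ : 0 ≤ θ)
    (ha0 : 0 ≤ a) (haA : a ≤ A) (hd : μ * (1 + e) ≤ c - e1) (hf : f * U ≤ k * U ^ 2)
    (hP : P = c * (1 + γ) - e1 + e * (a' + θ))
    (pde : -e * Z + T - c * Y + a' * W = f - a * W) :
    γ * W * T + (e * Y - W) * (e1 * Y + e * Z - T) - P' / 2 * (U * Y)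
      - P / 2 * (W * Y + U * Z) + a' * θ * U * W + θ * (W * W + U * T) - (1 + γ) * (f * W)
    ≤ (-(μ / 2) * e ^ 2) * Y ^ 2 + (-(γ * a') + A ^ 2 / (2 * μ) + θ + θ ^ 2 * A ^ 2 / 4) * W ^ 2
      + (θ * k + 1) * U ^ 2 + (P / 2 - e * θ) * (Y * W) + (-(P / 2 - e * θ)) * (U * Z)
      + (θ * c - P' / 2) * (U * Y) + (γ * e) * (W * Z) + (-e) * (f * Y) := by
  have hT : T = e * Z + c * Y - a' * W + f - a * W := by linarith
  have haa : a ^ 2 ≤ A ^ 2 := by nlinarith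
  have h1 : μ * e ^ 2 * Y ^ 2 ≤ e * (c - e1) * Y ^ 2 := by
    have : μ * e ^ 2 ≤ e * (c - e1) := by nlinarith
    exact mul_le_mul_of_nonneg_right this (sq_nonneg _)
  have h2 : e * a * Y * W ≤ (μ / 2) * e ^ 2 * Y ^ 2 + A ^ 2 / (2 * μ) * W ^ 2 := by
    have i1 : A ^ 2 / (2 * μ) * W ^ 2 ≥ a ^ 2 / (2 * μ) * W ^ 2 := by gcongr
    have i2 : 0 ≤ (μ * e * Y - a * W) ^ 2 / (2 * μ) := by positivity
    have i3 : (μ * e * Y - a * W) ^ 2 / (2 * μ)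
      = (μ / 2) * e ^ 2 * Y ^ 2 - e * a * Y * W + a ^ 2 / (2 * μ) * W ^ 2 := by
      field_simp
      ring
    linarith
  have h3 : - (θ * a * U * W) ≤ U ^ 2 + θ ^ 2 * A ^ 2 / 4 * W ^ 2 := by
    have i1 : θ ^ 2 * a ^ 2 / 4 * W ^ 2 ≤ θ ^ 2 * A ^ 2 / 4 * W ^ 2 := by gcongr
    nlinarith [sq_nonneg (U + θ * a * W / 2)]
  have h4 : θ * (f * U) ≤ θ * (k * U ^ 2) := mul_le_mul_of_nonneg_left hf hθ
  have h5 : 0 ≤ γ * a * W ^ 2 := by positivity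
  have h6 : 0 ≤ a' * W ^ 2 := by positivity
  have h7 : 0 ≤ a * W ^ 2 := by positivity
  rw [hT, hP]
  linarith

lemma aux_int_lin {U Y W Z f : ℝ → ℝ} (k1 k2 k3 k4 k5 k6 k7 k8 : ℝ)
    (hU : ContinuousOn U (Icc 0 π)) (hY : ContinuousOn Y (Icc 0 π))
    (hW : ContinuousOn W (Icc 0 π)) (hZ : ContinuousOn Z (Icc 0 π))
    (hf : ContinuousOn f (Icc 0 π)) :
    ∫ x in (0:ℝ)..π, (k1 * Y x ^ 2 + k2 * W x ^ 2 + k3 * U x ^ 2 + k4 * (Y x * W x)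
      + k5 * (U x * Z x) + k6 * (U x * Y x) + k7 * (W x * Z x) + k8 * (f x * Y x))
    = k1 * (∫ x in (0:ℝ)..π, Y x ^ 2) + k2 * (∫ x in (0:ℝ)..π, W x ^ 2)
      + k3 * (∫ x in (0:ℝ)..π, U x ^ 2) + k4 * (∫ x in (0:ℝ)..π, Y x * W x)
      + k5 * (∫ x in (0:ℝ)..π, U x * Z x) + k6 * (∫ x in (0:ℝ)..π, U x * Y x)
      + k7 * (∫ x in (0:ℝ)..π, W x * Z x) + k8 * (∫ x in (0:ℝ)..π, f x * Y x) := by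
  simp only [← intervalIntegral.integral_const_mul]
  iterate 7 rw [intervalIntegral.integral_add (aux_ii (by fun_prop)) (aux_ii (by fun_prop))]

lemma aux_pt_lower {U Y W e γ θ r φ k a' : ℝ} (hr : 0 < r) (ha' : 0 ≤ a') (hθ : 0 ≤ θ)
    (hγ : 0 ≤ γ) (hφ : 2 * φ ≤ k * U ^ 2) (P : ℝ) :
    (e ^ 2 / 4) * Y ^ 2 + ((γ - 1) / 2 - 2 * θ ^ 2 / r) * W ^ 2
      + (-(r / 8) - (1 + γ) * k / 2) * U ^ 2 + (-(P / 2)) * (U * Y)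
    ≤ γ / 2 * W ^ 2 + 1 / 2 * (e * Y - W) ^ 2 - P / 2 * (U * Y) + a' * θ / 2 * U ^ 2
      + θ * (U * W) - (1 + γ) * φ := by
  have h1 : -(r / 8) * U ^ 2 - 2 * θ ^ 2 / r * W ^ 2 ≤ θ * (U * W) := by
    have i3 : (r * U + 4 * θ * W) ^ 2 / (8 * r)
      = (r / 8) * U ^ 2 + 2 * θ ^ 2 / r * W ^ 2 + θ * (U * W) := by
      field_simp
      ring
    have : 0 ≤ (r * U + 4 * θ * W) ^ 2 / (8 * r) := by positivity
    linarith
  have h2 : (1 + γ) * (2 * φ) ≤ (1 + γ) * (k * U ^ 2) := mul_le_mul_of_nonneg_left hφ (by linarith)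
  have h3 : 0 ≤ a' * θ / 2 * U ^ 2 := by positivity
  nlinarith [sq_nonneg (e * Y / 2 - W)]

lemma aux_pt_upper {U Y W e γ θ φ l a' : ℝ} (hθ : 0 ≤ θ)
    (hγ : 0 ≤ γ) (hφ : -(2 * φ) ≤ l * U ^ 2) (P : ℝ) :
    γ / 2 * W ^ 2 + 1 / 2 * (e * Y - W) ^ 2 - P / 2 * (U * Y) + a' * θ / 2 * U ^ 2
      + θ * (U * W) - (1 + γ) * φ
    ≤ (e ^ 2) * Y ^ 2 + (γ / 2 + 1 + θ / 2) * W ^ 2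
      + (a' * θ / 2 + θ / 2 + (1 + γ) * l / 2) * U ^ 2 + (-(P / 2)) * (U * Y) := by
  have h2 : (1 + γ) * -(2 * φ) ≤ (1 + γ) * (l * U ^ 2) := mul_le_mul_of_nonneg_left hφ (by linarith)
  have h1 : θ * (U * W) ≤ θ * (U ^ 2 / 2 + W ^ 2 / 2) :=
    mul_le_mul_of_nonneg_left (by nlinarith [sq_nonneg (U - W)]) hθ
  nlinarith [sq_nonneg (e * Y + W)]

namespace ClassicalSolution

variable {ε C F : ℝ → ℝ} {a' t₀ : ℝ}

/-- energy density -/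
noncomputable def en (S : ClassicalSolution ε C F a' t₀) (γ θ : ℝ) (P : ℝ → ℝ) (x t : ℝ) : ℝ :=
  γ / 2 * S.ut x t ^ 2 + 1 / 2 * (ε t * S.uxx x t - S.ut x t) ^ 2
    - P t / 2 * (S.u x t * S.uxx x t) + a' * θ / 2 * S.u x t ^ 2
    + θ * (S.u x t * S.ut x t) - (1 + γ) * ∫ z in (0:ℝ)..(S.u x t), F z

noncomputable def en' (S : ClassicalSolution ε C F a' t₀) (γ θ : ℝ) (ε' P P' : ℝ → ℝ)
    (x t : ℝ) : ℝ :=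
  γ * S.ut x t * S.utt x t
    + (ε t * S.uxx x t - S.ut x t) * (ε' t * S.uxx x t + ε t * S.uxxt x t - S.utt x t)
    - P' t / 2 * (S.u x t * S.uxx x t)
    - P t / 2 * (S.ut x t * S.uxx x t + S.u x t * S.uxxt x t)
    + a' * θ * S.u x t * S.ut x t + θ * (S.ut x t * S.ut x t + S.u x t * S.utt x t)
    - (1 + γ) * (F (S.u x t) * S.ut x t)

noncomputable def V (S : ClassicalSolution ε C F a' t₀) (γ θ : ℝ) (P : ℝ → ℝ) (t : ℝ) : ℝ :=
  ∫ x in (0:ℝ)..π, S.en γ θ P x t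

lemma liftt {c : ℝ → ℝ} (hc : ContinuousOn c (Ici t₀)) :
    ContinuousOn (fun q : ℝ × ℝ => c q.2) (Icc 0 π ×ˢ Ici t₀) :=
  hc.comp (f := Prod.snd) (by fun_prop) (fun q hq => hq.2)

lemma prim_cont (hF : Continuous F) : Continuous fun u => ∫ z in (0:ℝ)..u, F z :=
  intervalIntegral.continuous_primitive (fun _ _ => hF.intervalIntegrable _ _) 0

lemma en_cont_aux (hF : Continuous F) {γ θ b : ℝ} {D : Set (ℝ × ℝ)}
    {u uxx ut e P : ℝ × ℝ → ℝ} (h1 : ContinuousOn u D) (h2 : ContinuousOn uxx D)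
    (h3 : ContinuousOn ut D) (h4 : ContinuousOn e D) (h5 : ContinuousOn P D) :
    ContinuousOn (fun q => γ / 2 * ut q ^ 2 + 1 / 2 * (e q * uxx q - ut q) ^ 2
    - P q / 2 * (u q * uxx q) + b * θ / 2 * u q ^ 2
    + θ * (u q * ut q) - (1 + γ) * ∫ z in (0:ℝ)..(u q), F z) D := by
  have h6 : ContinuousOn (fun q => ∫ z in (0:ℝ)..(u q), F z) D :=
    (prim_cont hF).comp_continuousOn h1
  fun_prop

lemma en_cont (S : ClassicalSolution ε C F a' t₀) (hF : Continuous F) {γ θ : ℝ} {P : ℝ → ℝ}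
    (hε : ContinuousOn ε (Ici t₀)) (hP : ContinuousOn P (Ici t₀)) :
    ContinuousOn (Function.uncurry (S.en γ θ P)) (Icc 0 π ×ˢ Ici t₀) :=
  en_cont_aux hF S.cont_u S.cont_uxx S.cont_ut (liftt hε) (liftt hP)

lemma en'_cont_aux (hF : Continuous F) {γ θ b : ℝ} {D : Set (ℝ × ℝ)}
    {u uxx ut utt uxxt e e1 P P' : ℝ × ℝ → ℝ} (h1 : ContinuousOn u D) (h2 : ContinuousOn uxx D)
    (h3 : ContinuousOn ut D) (h4 : ContinuousOn e D) (h5 : ContinuousOn P D)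
    (h6 : ContinuousOn utt D) (h7 : ContinuousOn uxxt D) (h8 : ContinuousOn e1 D)
    (h9 : ContinuousOn P' D) :
    ContinuousOn (fun q => γ * ut q * utt q
    + (e q * uxx q - ut q) * (e1 q * uxx q + e q * uxxt q - utt q)
    - P' q / 2 * (u q * uxx q)
    - P q / 2 * (ut q * uxx q + u q * uxxt q)
    + b * θ * u q * ut q + θ * (ut q * ut q + u q * utt q)
    - (1 + γ) * (F (u q) * ut q)) D := by
  have : ContinuousOn (fun q => F (u q)) D := hF.comp_continuousOn h1
  fun_prop

lemma en'_cont (S : ClassicalSolution ε C F a' t₀) (hF : Continuous F) {γ θ : ℝ}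
    {ε' P P' : ℝ → ℝ}
    (hε : ContinuousOn ε (Ici t₀)) (hP : ContinuousOn P (Ici t₀))
    (hε' : ContinuousOn ε' (Ici t₀)) (hP' : ContinuousOn P' (Ici t₀)) :
    ContinuousOn (Function.uncurry (S.en' γ θ ε' P P')) (Icc 0 π ×ˢ Ici t₀) :=
  en'_cont_aux hF S.cont_u S.cont_uxx S.cont_ut (liftt hε) (liftt hP) S.cont_utt S.cont_uxxt
    (liftt hε') (liftt hP')

lemma V_deriv (S : ClassicalSolution ε C F a' t₀) (hF : Continuous F) {γ θ : ℝ}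
    {ε' P P' : ℝ → ℝ}
    (hε : ContinuousOn ε (Ici t₀)) (hP : ContinuousOn P (Ici t₀))
    (hε' : ContinuousOn ε' (Ici t₀)) (hP' : ContinuousOn P' (Ici t₀))
    (dε : ∀ t, t₀ < t → HasDerivAt ε (ε' t) t) (dP : ∀ t, t₀ < t → HasDerivAt P (P' t) t)
    {t : ℝ} (ht : t₀ < t) :
    HasDerivAt (S.V γ θ P) (∫ x in (0:ℝ)..π, S.en' γ θ ε' P P' x t) t := by
  refine aux_leibniz (t₀ := t₀) ?_ (S.en_cont hF hε hP) (S.en'_cont hF hε hP hε' hP') ht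
  intro x hx s hs
  have d1 := dAt S.hut x hx s hs
  have d2 := dAt S.huxxt x hx s hs
  have d3 := dAt S.hutt x hx s hs
  have d4 := dε s hs
  have d5 := dP s hs
  have d6 : HasDerivAt (fun s => ∫ z in (0:ℝ)..(S.u x s), F z) (F (S.u x s) * S.ut x s) s :=
    HasDerivAt.comp s (intervalIntegral.integral_hasDerivAt_right (hF.intervalIntegrable _ _)
      (hF.stronglyMeasurableAtFilter _ _) hF.continuousAt) d1
  have := ((((((d3.pow 2).const_mul (γ / 2)).add ((((d4.mul d2).sub d3).pow 2).const_mul (1 / 2))).sub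
    ((d5.div_const 2).mul (d1.mul d2))).add ((d1.pow 2).const_mul (a' * θ / 2))).add
    ((d1.mul d3).const_mul θ)).sub (d6.const_mul (1 + γ))
  refine this.congr_deriv ?_
  simp only [en', Pi.mul_apply, Pi.sub_apply]
  push_cast
  ring

lemma V_cont (S : ClassicalSolution ε C F a' t₀) (hF : Continuous F) {γ θ : ℝ} {P : ℝ → ℝ}
    (hε : ContinuousOn ε (Ici t₀)) (hP : ContinuousOn P (Ici t₀)) :
    ContinuousOn (S.V γ θ P) (Ici t₀) :=
  aux_param_cont (S.en_cont hF hε hP)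

lemma int_nonneg (f : ℝ → ℝ) : 0 ≤ ∫ x in (0:ℝ)..π, f x ^ 2 :=
  intervalIntegral.integral_nonneg pi_pos.le fun _ _ => sq_nonneg _

lemma deriv_bound (S : ClassicalSolution ε C F a' t₀) {F' : ℝ → ℝ}
    (hF : ∀ z, HasDerivAt F (F' z) z) (hF' : Continuous F') (hF0 : F 0 = 0)
    {γ θ k μ A : ℝ} {ε' P P' : ℝ → ℝ} (hFk : ∀ z, F' z ≤ k)
    (hε : ContinuousOn ε (Ici t₀)) (hP : ContinuousOn P (Ici t₀))
    (hε' : ContinuousOn ε' (Ici t₀)) (hP' : ContinuousOn P' (Ici t₀))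
    (hA : ∀ x ∈ Icc (0:ℝ) π, ∀ t ∈ Ici t₀, S.aa x t ≤ A)
    (hk : 0 ≤ k) (hμ : 0 < μ) (ha' : 0 ≤ a') (hγ : 0 ≤ γ) (hθ : 0 ≤ θ)
    {t : ℝ} (ht : t₀ < t) (he : 0 ≤ ε t)
    (hd : μ * (1 + ε t) ≤ C t - ε' t)
    (hPt : P t = C t * (1 + γ) - ε' t + ε t * (a' + θ))
    (hm : (P' t / 2) + θ * k + 1 + ε t * k + (C t - ε' t / 2) ≤ θ * C t)
    (hγ2 : A ^ 2 / (2 * μ) + θ + θ ^ 2 * A ^ 2 / 4 + 1 ≤ γ * (ε t + a')) :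
    ∫ x in (0:ℝ)..π, S.en' γ θ ε' P P' x t ≤
      - (μ / 2 * ε t ^ 2 * (∫ x in (0:ℝ)..π, S.uxx x t ^ 2) + (∫ x in (0:ℝ)..π, S.ut x t ^ 2)
        + (C t - ε' t / 2) * ∫ x in (0:ℝ)..π, S.ux x t ^ 2) := by
  have hFc : Continuous F := continuous_iff_continuousAt.2 fun z => (hF z).continuousAt
  have c1 := slice S.cont_u ht.le
  have c2 := slice S.cont_uxx ht.le
  have c3 := slice S.cont_ut ht.le
  have c4 := slice S.cont_uxxt ht.le
  have c6 := slice S.cont_ux ht.le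
  have c5 : ContinuousOn (fun x => F (S.u x t)) (Icc 0 π) := hFc.comp_continuousOn c1
  have c7 : ContinuousOn (fun x => F' (S.u x t)) (Icc 0 π) := hF'.comp_continuousOn c1
  have hle := intervalIntegral.integral_mono_on_of_le_Ioo pi_pos.le
    (aux_ii (slice (S.en'_cont hFc (γ := γ) (θ := θ) hε hP hε' hP') ht.le))
    (aux_ii (f := fun x => (-(μ / 2) * ε t ^ 2) * S.uxx x t ^ 2
      + (-(γ * a') + A ^ 2 / (2 * μ) + θ + θ ^ 2 * A ^ 2 / 4) * S.ut x t ^ 2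
      + (θ * k + 1) * S.u x t ^ 2 + (P t / 2 - ε t * θ) * (S.uxx x t * S.ut x t)
      + (-(P t / 2 - ε t * θ)) * (S.u x t * S.uxxt x t)
      + (θ * C t - P' t / 2) * (S.u x t * S.uxx x t) + (γ * ε t) * (S.ut x t * S.uxxt x t)
      + (-ε t) * (F (S.u x t) * S.uxx x t)) (by fun_prop))
    (fun x hx => aux_pt_deriv he hμ ha' hγ hθ
      (S.aa_nonneg x (Ioo_subset_Icc_self hx) t ht.le) (hA x (Ioo_subset_Icc_self hx) t ht.le) hd
      (aux_Phi hF hF0 (M := |S.u x t|) (fun z _ => hFk z) _ le_rfl).2 hPt (S.pde x hx t ht))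
  rw [aux_int_lin _ _ _ _ _ _ _ _ c1 c2 c3 c4 c5, ← S.sym_t ht.le ht, S.D_eq ht.le,
    S.F_eq hF hF' hF0 ht.le] at hle
  have hdis := mul_le_mul_of_nonneg_left (S.diss ht) (mul_nonneg hγ he)
  have hFi : ∫ x in (0:ℝ)..π, F' (S.u x t) * S.ux x t ^ 2 ≤ k * ∫ x in (0:ℝ)..π, S.ux x t ^ 2 := by
    rw [← intervalIntegral.integral_const_mul]
    apply intervalIntegral.integral_mono_on pi_pos.le (aux_ii (by fun_prop)) (aux_ii (by fun_prop))
    intro x _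
    exact mul_le_mul_of_nonneg_right (hFk _) (sq_nonneg _)
  have hFi2 := mul_le_mul_of_nonneg_left hFi he
  have hp := mul_le_mul_of_nonneg_left (S.poinc ht.le) (by positivity : 0 ≤ θ * k + 1)
  have n1 := mul_le_mul_of_nonneg_right hm (int_nonneg fun x => S.ux x t)
  have n2 := mul_le_mul_of_nonneg_right hγ2 (int_nonneg fun x => S.ut x t)
  linarith

lemma d_sq (S : ClassicalSolution ε C F a' t₀) {t : ℝ} (ht : t₀ ≤ t) :
    S.d t ^ 2 = ε t ^ 2 * (∫ x in (0:ℝ)..π, S.uxx x t ^ 2) + (∫ x in (0:ℝ)..π, S.ux x t ^ 2)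
      + (∫ x in (0:ℝ)..π, S.u x t ^ 2) + ∫ x in (0:ℝ)..π, S.ut x t ^ 2 := by
  have c1 := slice S.cont_u ht
  have c2 := slice S.cont_uxx ht
  have c3 := slice S.cont_ut ht
  have c6 := slice S.cont_ux ht
  unfold d
  rw [Real.sq_sqrt (intervalIntegral.integral_nonneg pi_pos.le fun _ _ => by positivity),
    ← intervalIntegral.integral_const_mul]
  iterate 3 rw [intervalIntegral.integral_add (aux_ii (by fun_prop)) (aux_ii (by fun_prop))]

lemma V_lower (S : ClassicalSolution ε C F a' t₀) {F' : ℝ → ℝ}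
    (hF : ∀ z, HasDerivAt F (F' z) z) (hF0 : F 0 = 0)
    {γ θ k r c₀ : ℝ} {P : ℝ → ℝ} (hFk : ∀ z, F' z ≤ k)
    (hε : ContinuousOn ε (Ici t₀)) (hP : ContinuousOn P (Ici t₀))
    (hk : 0 ≤ k) (hr : 0 < r) (ha' : 0 ≤ a') (hγ : 0 ≤ γ) (hθ : 0 ≤ θ)
    {t : ℝ} (ht : t₀ ≤ t) (hPt : (1 + γ) * k + r ≤ P t)
    (h1 : c₀ ≤ 1 / 4) (h2 : c₀ ≤ r / 8) (h3 : 1 / 4 ≤ (γ - 1) / 2 - 2 * θ ^ 2 / r) :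
    c₀ * S.d t ^ 2 ≤ S.V γ θ P t := by
  have hFc : Continuous F := continuous_iff_continuousAt.2 fun z => (hF z).continuousAt
  have c1 := slice S.cont_u ht
  have c2 := slice S.cont_uxx ht
  have c3 := slice S.cont_ut ht
  have hle := intervalIntegral.integral_mono_on pi_pos.le
    (aux_ii (f := fun x => (ε t ^ 2 / 4) * S.uxx x t ^ 2
      + ((γ - 1) / 2 - 2 * θ ^ 2 / r) * S.ut x t ^ 2
      + (-(r / 8) - (1 + γ) * k / 2) * S.u x t ^ 2 + (-(P t / 2)) * (S.u x t * S.uxx x t))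
      (by fun_prop))
    (aux_ii (slice (S.en_cont hFc (γ := γ) (θ := θ) hε hP) ht))
    (fun x hx => aux_pt_lower hr ha' hθ hγ
      (aux_Phi hF hF0 (M := |S.u x t|) (fun z _ => hFk z) _ le_rfl).1 (P t))
  iterate 3 rw [intervalIntegral.integral_add (aux_ii (by fun_prop)) (aux_ii (by fun_prop))] at hle
  simp only [intervalIntegral.integral_const_mul] at hle
  rw [S.D_eq ht] at hle
  rw [S.d_sq ht]
  have hp := mul_le_mul_of_nonneg_left (S.poinc ht) (by positivity : 0 ≤ (1 + γ) * k / 2 + r / 4)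
  have nX := int_nonneg fun x => S.ux x t
  have nY := mul_nonneg (sq_nonneg (ε t)) (int_nonneg fun x => S.uxx x t)
  have nU := int_nonneg fun x => S.u x t
  have nW := int_nonneg fun x => S.ut x t
  have m1 := mul_le_mul_of_nonneg_right hPt nX
  have m2 := mul_le_mul_of_nonneg_right h3 nW
  have m3 := mul_le_mul_of_nonneg_right h1 nW
  have m4 := mul_le_mul_of_nonneg_right h1 nY
  have m5 := mul_le_mul_of_nonneg_right h2 nX
  have m6 := mul_le_mul_of_nonneg_right h2 nU
  have m7 := mul_nonneg hr.le nX
  change _ ≤ S.V γ θ P t at hle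
  linarith

lemma V_upper (S : ClassicalSolution ε C F a' t₀) {F' : ℝ → ℝ}
    (hF : ∀ z, HasDerivAt F (F' z) z) (hF0 : F 0 = 0)
    {γ θ l M : ℝ} {P : ℝ → ℝ} (hFl : ∀ z, |z| ≤ M → -F' z ≤ l)
    (hε : ContinuousOn ε (Ici t₀)) (hP : ContinuousOn P (Ici t₀))
    (hl : 0 ≤ l) (ha' : 0 ≤ a') (hγ : 0 ≤ γ) (hθ : 0 ≤ θ)
    {t : ℝ} (ht : t₀ ≤ t) (hM : π + S.d t ^ 2 ≤ M) :
    S.V γ θ P t ≤ ε t ^ 2 * (∫ x in (0:ℝ)..π, S.uxx x t ^ 2)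
      + (γ / 2 + 1 + θ / 2) * (∫ x in (0:ℝ)..π, S.ut x t ^ 2)
      + (P t / 2 + (a' * θ / 2 + θ / 2 + (1 + γ) * l / 2)) * ∫ x in (0:ℝ)..π, S.ux x t ^ 2 := by
  have hFc : Continuous F := continuous_iff_continuousAt.2 fun z => (hF z).continuousAt
  have c1 := slice S.cont_u ht
  have c2 := slice S.cont_uxx ht
  have c3 := slice S.cont_ut ht
  have nX := int_nonneg fun x => S.ux x t
  have nY := mul_nonneg (sq_nonneg (ε t)) (int_nonneg fun x => S.uxx x t)
  have nU := int_nonneg fun x => S.u x t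
  have nW := int_nonneg fun x => S.ut x t
  have hsup : ∀ x ∈ Icc (0:ℝ) π, |S.u x t| ≤ M := by
    intro x hx
    have := aux_sup (S.hux t ht) (slice S.cont_ux ht) (S.bc0 t ht) x hx
    rw [S.d_sq ht] at hM
    linarith
  have hle := intervalIntegral.integral_mono_on pi_pos.le
    (aux_ii (slice (S.en_cont hFc (γ := γ) (θ := θ) hε hP) ht))
    (aux_ii (f := fun x => (ε t ^ 2) * S.uxx x t ^ 2
      + (γ / 2 + 1 + θ / 2) * S.ut x t ^ 2
      + (a' * θ / 2 + θ / 2 + (1 + γ) * l / 2) * S.u x t ^ 2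
      + (-(P t / 2)) * (S.u x t * S.uxx x t))
      (by fun_prop))
    (fun x hx => aux_pt_upper hθ hγ (by
      have := (aux_Phi (G := fun z => - F z) (fun z => (hF z).neg) (by simp [hF0])
        hFl _ (hsup x hx)).1
      rw [intervalIntegral.integral_neg] at this
      linarith) (P t))
  iterate 3 rw [intervalIntegral.integral_add (aux_ii (by fun_prop)) (aux_ii (by fun_prop))] at hle
  simp only [intervalIntegral.integral_const_mul] at hle
  rw [S.D_eq ht] at hle
  have hp := mul_le_mul_of_nonneg_left (S.poinc ht)
    (by positivity : 0 ≤ a' * θ / 2 + θ / 2 + (1 + γ) * l / 2)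
  change S.V γ θ P t ≤ _ at hle
  linarith

end ClassicalSolution

lemma aux_decay {V V' : ℝ → ℝ} {t₀ c : ℝ} (hc : ContinuousOn V (Ici t₀))
    (hd : ∀ t, t₀ < t → HasDerivAt V (V' t) t) (hV : ∀ t, t₀ < t → V' t ≤ -c * V t) :
    ∀ t, t₀ ≤ t → V t ≤ V t₀ * exp (-c * (t - t₀)) := by
  intro t ht
  have hanti : AntitoneOn (fun s => V s * exp (c * (s - t₀))) (Ici t₀) := by
    have hD : ∀ s, t₀ < s → HasDerivAt (fun s => V s * exp (c * (s - t₀)))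
        (V' s * exp (c * (s - t₀)) + V s * (exp (c * (s - t₀)) * c)) s := by
      intro s hs
      refine (hd s hs).mul ?_
      have : HasDerivAt (fun s => c * (s - t₀)) c s := by
        simpa using ((hasDerivAt_id s).sub_const t₀).const_mul c
      exact this.exp
    apply antitoneOn_of_deriv_nonpos (convex_Ici t₀)
    · exact hc.mul (by fun_prop)
    · intro s hs
      rw [interior_Ici] at hs
      exact (hD s hs).differentiableAt.differentiableWithinAt
    · intro s hs
      rw [interior_Ici] at hs
      rw [(hD s hs).deriv]
      have := mul_le_mul_of_nonneg_right (hV s hs) (exp_pos (c * (s - t₀))).le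
      linarith
  have h := hanti (self_mem_Ici) (mem_Ici.2 ht) ht
  simp only [sub_self, mul_zero, exp_zero, mul_one] at h
  have h2 := mul_le_mul_of_nonneg_right h (exp_pos (-c * (t - t₀))).le
  rw [mul_assoc, ← exp_add] at h2
  simpa using h2


set_option maxHeartbeats 4000000 in
/-- Theorem 4.2, part 2 (asymptotic stability in the large): with `ρ = ∞`,
`τ = 0` (so `a ≤ A`), `∫₀^∞ dt/g(t) = ∞`, and `C' ≤ 0` or `C'(t) → 0`, the null
solution is asymptotically stable in the large. -/
theorem null_solution_asymptotically_stable_in_the_large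
    (ε ε' ε'' C C' F F' : ℝ → ℝ) (a' A k μ Cbar εbar ebar : ℝ)
    (hεderiv : ∀ t ∈ Ici (0:ℝ), HasDerivWithinAt ε (ε' t) (Ici 0) t)
    (hε'deriv : ∀ t ∈ Ici (0:ℝ), HasDerivWithinAt ε' (ε'' t) (Ici 0) t)
    (hε''cont : ContinuousOn ε'' (Ici 0))
    (hεnonneg : ∀ t ∈ Ici (0:ℝ), 0 ≤ ε t)
    (hCderiv : ∀ t ∈ Ici (0:ℝ), HasDerivWithinAt C (C' t) (Ici 0) t)
    (hC'cont : ContinuousOn C' (Ici 0))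
    (hFderiv : ∀ z, HasDerivAt F (F' z) z)
    (hF'cont : Continuous F')
    (hF0 : F 0 = 0)
    (hCbar : IsGLB (C '' Ioi (0:ℝ)) Cbar) (hCbarpos : 0 < Cbar)
    (hεbar : IsGLB (ε '' Ioi (0:ℝ)) εbar)
    (hebar : IsGLB (ε'' '' Ioi (0:ℝ)) ebar)
    (hA : 0 ≤ A) (hk : 0 ≤ k) (hμ : 0 < μ)
    (hFk : ∀ z, F' z ≤ k)
    (hCk : k ≤ Cbar)
    (hdiss : ∀ t ∈ Ici (0:ℝ), μ * (1 + ε t) ≤ C t - ε' t)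
    (hmuk : 0 < μ + Cbar / 2 - 2 * k)
    (ha' : 0 ≤ a')
    (ha'ε : 0 < a' + εbar / 2)
    (hg : Tendsto (fun T => ∫ t in (0:ℝ)..T, 1 / (C t - ε' t / 2 + 1)) atTop atTop)
    (hC' : (∀ t ∈ Ici (0:ℝ), C' t ≤ 0) ∨ Tendsto C' atTop (nhds 0))
    :
    (∃ ξ, 0 < ξ ∧ ∃ κ, 0 ≤ κ ∧
      ∀ σ, 0 < σ → σ ≤ ξ → ∀ t₀, κ ≤ t₀ →
        ∃ δ, 0 < δ ∧
          ∀ S : ClassicalSolution ε C F a' t₀,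
            (∀ x ∈ Icc (0:ℝ) π, ∀ t ∈ Ici t₀, S.aa x t ≤ A) →
            S.d t₀ < δ → ∀ t, t₀ ≤ t → S.d t < σ) ∧
    (∃ κ, 0 ≤ κ ∧ ∀ t₀, κ ≤ t₀ → ∀ α, 0 < α →
      ∀ S : ClassicalSolution ε C F a' t₀,
        (∀ x ∈ Icc (0:ℝ) π, ∀ t ∈ Ici t₀, S.aa x t ≤ A) →
        S.d t₀ < α →
        Tendsto S.d atTop (nhds 0) ∧
          ∀ ν, 0 < ν → ∃ T, 0 < T ∧ ∀ t, t₀ + T ≤ t → S.d t < ν) := by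
  have hFc : Continuous F := continuous_iff_continuousAt.2 fun z => (hFderiv z).continuousAt
  have hεb0 : 0 ≤ εbar := hεbar.2 (by
    rintro _ ⟨t, ht, rfl⟩
    exact hεnonneg t (mem_Ici.2 (le_of_lt ht)))
  -- constants
  obtain ⟨η, hη, hηpos⟩ : ∃ η, η = (Cbar + μ) / 2 - k ∧ 0 < η := ⟨_, rfl, by linarith⟩
  obtain ⟨r, hr, hrpos⟩ : ∃ r, r = Cbar + μ - 2 * k ∧ 0 < r := ⟨_, rfl, by linarith⟩
  have hkη : 0 < k + η := by linarith
  obtain ⟨q, hq, hqpos⟩ : ∃ q, q = η / (k + η) ∧ 0 < q := ⟨_, rfl, by positivity⟩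
  obtain ⟨θ, hθ, hθ0⟩ : ∃ θ, θ * q = a' + |ebar| / μ + 2 * k / μ + 3 / μ + 1 ∧ 0 ≤ θ :=
    ⟨(a' + |ebar| / μ + 2 * k / μ + 3 / μ + 1) / q, by field_simp, by positivity⟩
  obtain ⟨a0, ha0, ha0pos⟩ : ∃ a0, a0 = a' + εbar / 2 ∧ 0 < a0 := ⟨_, rfl, ha'ε⟩
  obtain ⟨γ, hγ⟩ : ∃ γ, γ = 2 + 4 * θ ^ 2 / r + (A ^ 2 / (2 * μ) + θ + θ ^ 2 * A ^ 2 / 4 + 1) / a0 :=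
    ⟨_, rfl⟩
  have hγr : 2 + 4 * θ ^ 2 / r ≤ γ := by
    rw [hγ]; exact le_add_of_nonneg_right (by positivity)
  have hγ2 : 2 ≤ γ := by
    have : 0 ≤ 4 * θ ^ 2 / r := by positivity
    linarith
  have hγ0 : 0 ≤ γ := by linarith
  have hγa : A ^ 2 / (2 * μ) + θ + θ ^ 2 * A ^ 2 / 4 + 1 ≤ γ * a0 := by
    have h1 : (A ^ 2 / (2 * μ) + θ + θ ^ 2 * A ^ 2 / 4 + 1) / a0 ≤ γ := by
      rw [hγ]; exact le_add_of_nonneg_left (by positivity)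
    exact (div_le_iff₀ ha0pos).1 h1
  have h3 : 1 / 4 ≤ (γ - 1) / 2 - 2 * θ ^ 2 / r := by
    have : 4 * θ ^ 2 / r = 2 * (2 * θ ^ 2 / r) := by ring
    linarith
  obtain ⟨c₀, hc0, hc1, hc2⟩ : ∃ c₀, 0 < c₀ ∧ c₀ ≤ 1 / 4 ∧ c₀ ≤ r / 8 :=
    ⟨min (1 / 4) (r / 8), by positivity, min_le_left _ _, min_le_right _ _⟩
  obtain ⟨κ, hκ1, hκ⟩ : ∃ κ, 1 ≤ κ ∧ ∀ t, κ ≤ t → C' t * (1 + γ) ≤ 1 := by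
    rcases hC' with h | h
    · refine ⟨1, le_rfl, fun t ht => ?_⟩
      have := h t (mem_Ici.2 (by linarith))
      nlinarith
    · have hev : ∀ᶠ t in atTop, C' t < 1 / (1 + γ) := h.eventually_lt_const (by positivity)
      obtain ⟨κ, hκ⟩ := eventually_atTop.1 hev
      refine ⟨max 1 κ, le_max_left _ _, fun t ht => ?_⟩
      have := hκ t ((le_max_right _ _).trans ht)
      rw [lt_div_iff₀ (by linarith)] at this
      exact this.le
  obtain ⟨P, hP⟩ : ∃ P : ℝ → ℝ, P = fun t => C t * (1 + γ) - ε' t + ε t * (a' + θ) := ⟨_, rfl⟩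
  obtain ⟨P', hP'⟩ : ∃ P' : ℝ → ℝ, P' = fun t => C' t * (1 + γ) - ε'' t + ε' t * (a' + θ) :=
    ⟨_, rfl⟩
  have cε : ContinuousOn ε (Ici 0) := fun t ht => (hεderiv t ht).continuousWithinAt
  have cε' : ContinuousOn ε' (Ici 0) := fun t ht => (hε'deriv t ht).continuousWithinAt
  have cC : ContinuousOn C (Ici 0) := fun t ht => (hCderiv t ht).continuousWithinAt
  have cP : ContinuousOn P (Ici 0) := by rw [hP]; fun_prop
  have cP' : ContinuousOn P' (Ici 0) := by rw [hP']; fun_prop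
  have dε : ∀ t, 0 < t → HasDerivAt ε (ε' t) t := fun t ht =>
    (hεderiv t (mem_Ici.2 ht.le)).hasDerivAt (Ici_mem_nhds ht)
  have dP : ∀ t, 0 < t → HasDerivAt P (P' t) t := by
    intro t ht
    have d2 := (hε'deriv t (mem_Ici.2 ht.le)).hasDerivAt (Ici_mem_nhds ht)
    have d3 := (hCderiv t (mem_Ici.2 ht.le)).hasDerivAt (Ici_mem_nhds ht)
    rw [hP, hP']
    exact ((d3.mul_const _).sub d2).add ((dε t ht).mul_const _)
  -- pointwise facts in time
  have hCb : ∀ t, 0 < t → Cbar ≤ C t := fun t ht => hCbar.1 ⟨t, ht, rfl⟩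
  have hεb : ∀ t, 0 < t → εbar ≤ ε t := fun t ht => hεbar.1 ⟨t, ht, rfl⟩
  have heb : ∀ t, 0 < t → ebar ≤ ε'' t := fun t ht => hebar.1 ⟨t, ht, rfl⟩
  obtain ⟨G, hG⟩ : ∃ G : ℝ → ℝ, ∀ t, G t = C t - ε' t / 2 := ⟨_, fun _ => rfl⟩
  have hε0 : ∀ t, 0 < t → 0 ≤ ε t := fun t ht => hεnonneg t (mem_Ici.2 ht.le)
  have hdi : ∀ t, 0 < t → μ * (1 + ε t) ≤ C t - ε' t := fun t ht => hdiss t (mem_Ici.2 ht.le)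
  have hC2G : ∀ t, 0 < t → C t ≤ 2 * G t := by
    intro t ht
    have := hdi t ht; have := hε0 t ht
    rw [hG]; nlinarith
  have hεG : ∀ t, 0 < t → (1 + ε t) ≤ 2 / μ * G t := by
    intro t ht
    have h1 := hdi t ht
    have h2 := hCb t ht
    rw [div_mul_eq_mul_div, le_div_iff₀ hμ, hG]
    linarith
  have h1G : ∀ t, 0 < t → 1 ≤ 2 / μ * G t := fun t ht => by linarith [hεG t ht, hε0 t ht]
  have hGk : ∀ t, 0 < t → k + η ≤ G t := by
    intro t ht
    have h1 := hdi t ht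
    have h2 := hCb t ht
    have h3 := mul_nonneg hμ.le (hε0 t ht)
    rw [hG, hη]; linarith
  have hGq : ∀ t, 0 < t → q * G t ≤ G t - k := by
    intro t ht
    have h1 := hGk t ht
    rw [hq, div_mul_eq_mul_div, div_le_iff₀ hkη]
    nlinarith
  have hG0 : ∀ t, 0 < t → 0 ≤ G t := fun t ht => by linarith [hGk t ht]
  have hm : ∀ t, κ ≤ t → (P' t / 2) + θ * k + 1 + ε t * k + (C t - ε' t / 2) ≤ θ * C t := by
    intro t htκ
    have ht : 0 < t := by linarith
    have b1 := hκ t htκ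
    have b2 := heb t ht
    have b3 := mul_le_mul_of_nonneg_left (hGq t ht) hθ0
    have b4 := h1G t ht
    have b5 := mul_le_mul_of_nonneg_right (hεG t ht) hk
    have b6 := mul_le_mul_of_nonneg_left (hC2G t ht) ha'
    have b7 := mul_le_mul_of_nonneg_right b4 (abs_nonneg ebar)
    have b8 := neg_abs_le ebar
    have e1 : θ * (q * G t) = a' * G t + (2 / μ * G t) * |ebar| / 2 + (2 / μ * G t) * k
        + 3 / 2 * (2 / μ * G t) + G t := by
      rw [← mul_assoc, hθ]; ring
    have e2 : ε' t = 2 * (C t - G t) := by rw [hG]; ring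
    have e3 : C t - ε' t / 2 = G t := (hG t).symm
    rw [e3, hP']
    simp only
    rw [e2]
    rw [e1] at b3
    have b9 : θ * G t = θ * C t - θ * (C t - G t) := by ring
    linarith
  have hγt : ∀ t, 0 < t → A ^ 2 / (2 * μ) + θ + θ ^ 2 * A ^ 2 / 4 + 1 ≤ γ * (ε t + a') := by
    intro t ht
    refine hγa.trans (mul_le_mul_of_nonneg_left ?_ hγ0)
    linarith [hεb t ht]
  have hPlow : ∀ t, 0 < t → (1 + γ) * k + r ≤ P t := by
    intro t ht
    have b1 := mul_le_mul_of_nonneg_left (hCb t ht) hγ0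
    have b2 := hdi t ht
    have b3 := mul_nonneg hμ.le (hε0 t ht)
    have b4 := mul_nonneg (hε0 t ht) (by positivity : 0 ≤ a' + θ)
    have b5 := mul_nonneg (by linarith : 0 ≤ γ - 1) (by linarith : 0 ≤ Cbar - k)
    rw [hP, hr]
    simp only
    linarith
  have hPup : ∀ t, 0 < t → P t ≤ (2 * γ + 2 + 2 / μ * (a' + θ)) * G t := by
    intro t ht
    have b1 := mul_le_mul_of_nonneg_left (hC2G t ht) hγ0
    have b2 := mul_le_mul_of_nonneg_right (hεG t ht) (by positivity : 0 ≤ a' + θ)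
    have b3 : C t - ε' t = 2 * G t - C t := by rw [hG]; ring
    have b4 := hCb t ht
    rw [hP]
    simp only
    have : 0 ≤ a' + θ := by positivity
    linarith
  -- facts about solutions
  have sub : ∀ {t₀ : ℝ}, κ ≤ t₀ → Ici t₀ ⊆ Ici (0:ℝ) := fun h => Ici_subset_Ici.2 (by linarith)
  have low : ∀ t₀, κ ≤ t₀ → ∀ S : ClassicalSolution ε C F a' t₀, ∀ t, t₀ ≤ t →
      c₀ * S.d t ^ 2 ≤ S.V γ θ P t := by
    intro t₀ h0 S t ht
    exact S.V_lower hFderiv hF0 hFk (cε.mono (sub h0)) (cP.mono (sub h0)) hk hrpos ha' hγ0 hθ0 ht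
      (hPlow t (by linarith)) hc1 hc2 h3
  have der : ∀ t₀, κ ≤ t₀ → ∀ S : ClassicalSolution ε C F a' t₀, ∀ t, t₀ < t →
      HasDerivAt (S.V γ θ P) (∫ x in (0:ℝ)..π, S.en' γ θ ε' P P' x t) t := by
    intro t₀ h0 S t ht
    exact S.V_deriv hFc (cε.mono (sub h0)) (cP.mono (sub h0)) (cε'.mono (sub h0))
      (cP'.mono (sub h0)) (fun t ht => dε t (by linarith)) (fun t ht => dP t (by linarith)) ht
  have bnd : ∀ t₀, κ ≤ t₀ → ∀ S : ClassicalSolution ε C F a' t₀,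
      (∀ x ∈ Icc (0:ℝ) π, ∀ t ∈ Ici t₀, S.aa x t ≤ A) → ∀ t, t₀ < t →
      ∫ x in (0:ℝ)..π, S.en' γ θ ε' P P' x t ≤
      - (μ / 2 * ε t ^ 2 * (∫ x in (0:ℝ)..π, S.uxx x t ^ 2) + (∫ x in (0:ℝ)..π, S.ut x t ^ 2)
        + (C t - ε' t / 2) * ∫ x in (0:ℝ)..π, S.ux x t ^ 2) := by
    intro t₀ h0 S hSA t ht
    have ht0 : 0 < t := by linarith
    exact S.deriv_bound hFderiv hF'cont hF0 hFk (cε.mono (sub h0)) (cP.mono (sub h0))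
      (cε'.mono (sub h0)) (cP'.mono (sub h0)) hSA hk hμ ha' hγ0 hθ0 ht (hε0 t ht0) (hdi t ht0)
      (by rw [hP]) (hm t (by linarith)) (hγt t ht0)
  have mono : ∀ t₀, κ ≤ t₀ → ∀ S : ClassicalSolution ε C F a' t₀,
      (∀ x ∈ Icc (0:ℝ) π, ∀ t ∈ Ici t₀, S.aa x t ≤ A) → ∀ t, t₀ ≤ t →
      S.V γ θ P t ≤ S.V γ θ P t₀ := by
    intro t₀ h0 S hSA t ht
    have := aux_decay (c := 0) (S.V_cont hFc (γ := γ) (θ := θ) (cε.mono (sub h0)) (cP.mono (sub h0)))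
      (der t₀ h0 S) (fun s hs => by
        have b := bnd t₀ h0 S hSA s hs
        have n1 := ClassicalSolution.int_nonneg fun x => S.uxx x s
        have n2 := ClassicalSolution.int_nonneg fun x => S.ut x s
        have n3 := mul_nonneg (hG0 s (by linarith))
          (ClassicalSolution.int_nonneg fun x => S.ux x s)
        rw [hG] at n3
        have n4 : 0 ≤ μ / 2 * ε s ^ 2 * (∫ x in (0:ℝ)..π, S.uxx x s ^ 2) := by positivity
        linarith) t ht
    simpa using this
  have lex : ∀ M : ℝ, ∃ l, 0 ≤ l ∧ ∀ z, |z| ≤ M → -F' z ≤ l := by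
    intro M
    obtain ⟨B, hB⟩ := (isCompact_Icc (a := -M) (b := M)).exists_bound_of_continuousOn
      hF'cont.continuousOn
    refine ⟨max B 0, le_max_right _ _, fun z hz => ?_⟩
    have := hB z (abs_le.1 hz)
    rw [Real.norm_eq_abs] at this
    exact ((neg_le_abs _).trans this).trans (le_max_left _ _)
  have dnn : ∀ t₀, ∀ S : ClassicalSolution ε C F a' t₀, ∀ t, 0 ≤ S.d t :=
    fun t₀ S t => Real.sqrt_nonneg _
  refine ⟨⟨1, one_pos, κ, by linarith, ?_⟩, κ, by linarith, ?_⟩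
  · intro σ hσ _ t₀ h0
    have ht0 : 0 < t₀ := by linarith
    obtain ⟨l, hl0, hl⟩ := lex (π + 1)
    obtain ⟨Q, hQ⟩ : ∃ Q, Q = 1 + (γ / 2 + 1 + θ / 2)
        + |P t₀ / 2 + (a' * θ / 2 + θ / 2 + (1 + γ) * l / 2)| := ⟨_, rfl⟩
    have ab := abs_nonneg (P t₀ / 2 + (a' * θ / 2 + θ / 2 + (1 + γ) * l / 2))
    have ab' := le_abs_self (P t₀ / 2 + (a' * θ / 2 + θ / 2 + (1 + γ) * l / 2))
    have hQ1 : 1 ≤ Q := by rw [hQ]; linarith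
    refine ⟨min 1 (σ * (c₀ / Q)), by positivity, ?_⟩
    intro S hSA hS t ht
    have hd1 : S.d t₀ < 1 := hS.trans_le (min_le_left _ _)
    have hd2 : S.d t₀ < σ * (c₀ / Q) := hS.trans_le (min_le_right _ _)
    have dn := dnn t₀ S t₀
    have up := S.V_upper hFderiv hF0 (γ := γ) (θ := θ) hl (cε.mono (sub h0)) (cP.mono (sub h0))
      hl0 ha' hγ0 hθ0 le_rfl (by nlinarith)
    have nX := ClassicalSolution.int_nonneg fun x => S.ux x t₀
    have nY := mul_nonneg (sq_nonneg (ε t₀)) (ClassicalSolution.int_nonneg fun x => S.uxx x t₀)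
    have nU := ClassicalSolution.int_nonneg fun x => S.u x t₀
    have nW := ClassicalSolution.int_nonneg fun x => S.ut x t₀
    have hup : S.V γ θ P t₀ ≤ Q * S.d t₀ ^ 2 := by
      rw [S.d_sq le_rfl]
      have m1 := mul_le_mul_of_nonneg_right
        (by rw [hQ]; linarith : P t₀ / 2 + (a' * θ / 2 + θ / 2 + (1 + γ) * l / 2) ≤ Q) nX
      have m2 := mul_le_mul_of_nonneg_right (by rw [hQ]; linarith : γ / 2 + 1 + θ / 2 ≤ Q) nW
      have m3 := mul_le_mul_of_nonneg_right hQ1 nY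
      have m4 := mul_nonneg (by linarith : 0 ≤ Q) nU
      linarith
    have l1 := low t₀ h0 S t ht
    have l2 := mono t₀ h0 S hSA t ht
    have hQp : 0 < Q := by linarith
    have hsq : S.d t₀ ^ 2 < (σ * (c₀ / Q)) ^ 2 := by gcongr
    have l3 : c₀ * S.d t ^ 2 < Q * (σ * (c₀ / Q)) ^ 2 := by
      have := mul_lt_mul_of_pos_left hsq hQp
      linarith
    have e : Q * (σ * (c₀ / Q)) ^ 2 = c₀ * (σ ^ 2 * (c₀ / Q)) := by field_simp
    rw [e] at l3
    have l4 := lt_of_mul_lt_mul_left l3 hc0.le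
    have hcQ : c₀ / Q ≤ 1 := by rw [div_le_one hQp]; linarith
    have l5 : S.d t ^ 2 < σ ^ 2 := by nlinarith [sq_nonneg σ]
    exact lt_of_pow_lt_pow_left₀ 2 hσ.le l5
  · intro t₀ h0 α hα S hSA hS
    have ht0 : 0 < t₀ := by linarith
    obtain ⟨l, hl0, hl⟩ := lex (π + S.V γ θ P t₀ / c₀)
    obtain ⟨K, hK⟩ : ∃ K, K = (γ / 2 + 1 + θ / 2) + 2 / μ
      + ((2 * γ + 2 + 2 / μ * (a' + θ)) / 2
        + (a' * θ / 2 + θ / 2 + (1 + γ) * l / 2) * (2 / μ)) := ⟨_, rfl⟩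
    have hk1 : 0 < γ / 2 + 1 + θ / 2 := by positivity
    have hk2 : 0 < 2 / μ := by positivity
    have hk3 : 0 ≤ (a' * θ / 2 + θ / 2 + (1 + γ) * l / 2) := by positivity
    have hk4 : 0 ≤ (2 * γ + 2 + 2 / μ * (a' + θ)) / 2
        + (a' * θ / 2 + θ / 2 + (1 + γ) * l / 2) * (2 / μ) := by positivity
    have hKp : 0 < K := by rw [hK]; linarith
    have hVN : ∀ t, t₀ < t → ∫ x in (0:ℝ)..π, S.en' γ θ ε' P P' x t ≤
        -(1 / K) * S.V γ θ P t := by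
      intro t ht
      have htp : 0 < t := by linarith
      have b := bnd t₀ h0 S hSA t ht
      have l1 := low t₀ h0 S t ht.le
      have l2 := mono t₀ h0 S hSA t ht.le
      have hM : π + S.d t ^ 2 ≤ π + S.V γ θ P t₀ / c₀ := by
        have : S.d t ^ 2 ≤ S.V γ θ P t₀ / c₀ := by
          rw [le_div_iff₀ hc0]; linarith
        linarith
      have up := S.V_upper hFderiv hF0 (γ := γ) (θ := θ) hl (cε.mono (sub h0)) (cP.mono (sub h0))
        hl0 ha' hγ0 hθ0 ht.le hM
      have nX := ClassicalSolution.int_nonneg fun x => S.ux x t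
      have nY := mul_nonneg (sq_nonneg (ε t)) (ClassicalSolution.int_nonneg fun x => S.uxx x t)
      have nW := ClassicalSolution.int_nonneg fun x => S.ut x t
      have m1 : P t / 2 + (a' * θ / 2 + θ / 2 + (1 + γ) * l / 2) ≤ K * G t := by
        have i1 := hPup t htp
        have i2 := mul_le_mul_of_nonneg_left (h1G t htp) hk3
        have i3 := mul_nonneg (by linarith : 0 ≤ (γ / 2 + 1 + θ / 2) + 2 / μ) (hG0 t htp)
        rw [hK]
        linarith
      have m2 := mul_le_mul_of_nonneg_right m1 nX
      have m3 := mul_le_mul_of_nonneg_right (by rw [hK]; linarith : γ / 2 + 1 + θ / 2 ≤ K) nW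
      have m4 : 1 ≤ K * (μ / 2) := by
        have : 2 / μ ≤ K := by rw [hK]; linarith
        rw [div_le_iff₀ hμ] at this
        linarith
      have m5 := mul_le_mul_of_nonneg_right m4 nY
      rw [← hG] at b
      have fin : S.V γ θ P t ≤ K * (- ∫ x in (0:ℝ)..π, S.en' γ θ ε' P P' x t) := by
        have := mul_le_mul_of_nonneg_left b hKp.le
        linarith
      have e : -(1 / K) * S.V γ θ P t = -(S.V γ θ P t / K) := by ring
      rw [e]
      have : S.V γ θ P t / K ≤ - ∫ x in (0:ℝ)..π, S.en' γ θ ε' P P' x t := by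
        rw [div_le_iff₀ hKp]; linarith
      linarith
    have dec := aux_decay (S.V_cont hFc (γ := γ) (θ := θ) (cε.mono (sub h0)) (cP.mono (sub h0)))
      (der t₀ h0 S) hVN
    have hlim : Tendsto (fun t => S.V γ θ P t₀ * exp (-(1 / K) * (t - t₀)) / c₀) atTop (nhds 0) := by
      have t1 : Tendsto (fun t => (1 / K) * (t - t₀)) atTop atTop :=
        (tendsto_atTop_add_const_right atTop (-t₀) tendsto_id).const_mul_atTop (by positivity)
      have t2 := ((Real.tendsto_exp_neg_atTop_nhds_zero.comp t1).const_mul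
        (S.V γ θ P t₀)).div_const c₀
      simpa [Function.comp_def, neg_mul] using t2
    have hsq : Tendsto (fun t => S.d t ^ 2) atTop (nhds 0) := by
      apply squeeze_zero' (Eventually.of_forall fun t => sq_nonneg _) _ hlim
      filter_upwards [eventually_ge_atTop t₀] with t ht
      rw [le_div_iff₀ hc0]
      linarith [low t₀ h0 S t ht, dec t ht]
    have hlimd : Tendsto S.d atTop (nhds 0) := by
      have := hsq.sqrt
      simp only [Real.sqrt_zero] at this
      refine this.congr fun t => Real.sqrt_sq (dnn t₀ S t)
    refine ⟨hlimd, fun ν hν => ?_⟩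
    obtain ⟨T, hT⟩ := eventually_atTop.1 (hlimd.eventually_lt_const hν)
    refine ⟨max 1 (T - t₀), lt_max_of_lt_left one_pos, fun t ht => hT t ?_⟩
    linarith [le_max_right 1 (T - t₀)]
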